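/- arXiv:1102.2484 — 4 statements merged into one kernel-verified Lean document; each statement's English description precedes it below -/
import Mathlib

section
/- Let p be a prime, let s ≥ 1 and n_1, …, n_s ≥ 1 be integers, and let m be a positive integer. If there exists an injective group homomorphism from the direct product ℤ/p^{n_1}ℤ × ⋯ × ℤ/p^{n_s}ℤ into the symmetric group S_m (the group of permutations of a set with m elements), then p^{n_1} + ⋯ + p^{n_s} ≤ m. -/
namespace CycBound

/-- number of elements of order dividing `p` which are `p ^ k`-th powers -/
noncomputable def tau (p k : ℕ) (A : Type*) [CommGroup A] : ℕ :=
  Nat.card {x : A // x ^ p = 1 ∧ ∃ y, y ^ (p ^ k) = x}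

lemma tau_mono (p k : ℕ) {A B : Type*} [CommGroup A] [CommGroup B] [Finite B]
    (f : A →* B) (hf : Function.Injective f) : tau p k A ≤ tau p k B := by
  unfold tau
  refine Nat.card_le_card_of_injective
    (fun x => ⟨f x.1, by rw [← map_pow, x.2.1, map_one], ?_⟩) ?_
  · obtain ⟨y, hy⟩ := x.2.2
    exact ⟨f y, by rw [← map_pow, hy]⟩
  · intro x y h
    exact Subtype.ext (hf (congrArg Subtype.val h))

lemma tau_pi (p k : ℕ) {ι : Type*} [Fintype ι] (A : ι → Type*) [∀ i, CommGroup (A i)] :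
    tau p k (∀ i, A i) = ∏ i, tau p k (A i) := by
  unfold tau
  rw [← Nat.card_pi]
  refine Nat.card_congr (Equiv.trans (Equiv.subtypeEquivRight ?_)
    (Equiv.subtypePiEquivPi (p := fun i (x : A i) => x ^ p = 1 ∧ ∃ y, y ^ (p ^ k) = x)))
  intro x
  constructor
  · rintro ⟨h, y, hy⟩ i
    exact ⟨congrFun h i, y i, congrFun hy i⟩
  · intro h
    choose h1 y hy using h
    exact ⟨funext h1, y, funext hy⟩

lemma tau_zmod_le (p k N : ℕ) (hp : p.Prime) (hN : N ≠ 0) :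
    tau p k (Multiplicative (ZMod N)) ≤ p ^ (if p ^ (k + 1) ∣ N then 1 else 0) := by
  have : NeZero N := ⟨hN⟩
  have := Fact.mk hp
  classical
  split_ifs with h
  · rw [pow_one]
    refine le_trans ?_ (IsCyclic.card_pow_eq_one_le (α := Multiplicative (ZMod N)) hp.pos)
    unfold tau
    rw [← Fintype.card_subtype, ← Nat.card_eq_fintype_card]
    exact Nat.card_le_card_of_injective (fun x => ⟨x.1, x.2.1⟩)
      (fun x y h => Subtype.ext (Subtype.mk.inj h))
  · rw [pow_zero]
    unfold tau
    have : ∀ x : {x : Multiplicative (ZMod N) // x ^ p = 1 ∧ ∃ y, y ^ (p ^ k) = x}, x.1 = 1 := by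
      rintro ⟨x, hx, y, rfl⟩
      by_contra hne
      apply h
      have ho : orderOf y = p ^ (k + 1) :=
        orderOf_eq_prime_pow hne (by rw [pow_succ, pow_mul]; exact hx)
      rw [← ho]
      have := orderOf_dvd_natCard y
      simpa using this
    have : Subsingleton {x : Multiplicative (ZMod N) // x ^ p = 1 ∧ ∃ y, y ^ (p ^ k) = x} :=
      ⟨fun a b => Subtype.ext ((this a).trans (this b).symm)⟩
    exact Finite.card_le_one_iff_subsingleton.2 this

lemma le_tau_zmod (p k n : ℕ) (hp : p.Prime) :
    p ^ (if p ^ (k + 1) ∣ p ^ n then 1 else 0) ≤ tau p k (Multiplicative (ZMod (p ^ n))) := by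
  have : NeZero (p ^ n) := ⟨pow_ne_zero _ hp.ne_zero⟩
  have := Fact.mk hp
  split_ifs with h
  · have hk : k + 1 ≤ n := (Nat.pow_dvd_pow_iff_le_right hp.one_lt).1 h
    rw [pow_one]
    -- an element of order p ^ (k+1)
    obtain ⟨y, hy⟩ : ∃ y : Multiplicative (ZMod (p ^ n)), orderOf y = p ^ (k + 1) := by
      obtain ⟨g, hg⟩ := IsCyclic.exists_ofOrder_eq_natCard (α := Multiplicative (ZMod (p ^ n)))
      have hg' : orderOf g = p ^ n := by simpa using hg
      refine ⟨g ^ (p ^ (n - (k + 1))), ?_⟩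
      have e : p ^ n = p ^ (k + 1) * p ^ (n - (k + 1)) := by rw [← pow_add]; congr 1; omega
      rw [orderOf_pow_of_dvd (pow_ne_zero _ hp.ne_zero) (by rw [hg', e]; exact dvd_mul_left _ _),
        hg', e]
      exact Nat.mul_div_cancel _ (pow_pos hp.pos _)
    have hz : orderOf (y ^ (p ^ k)) = p := by
      rw [orderOf_pow_of_dvd (pow_ne_zero _ hp.ne_zero) (by rw [hy]; exact pow_dvd_pow _ (by omega)),
        hy, pow_succ]
      exact Nat.mul_div_cancel_left _ (pow_pos hp.pos _)
    unfold tau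
    conv_lhs => rw [← hz, ← Nat.card_zpowers]
    refine Nat.card_le_card_of_injective (fun x => ⟨x.1, ?_, ?_⟩)
      (fun x y h => Subtype.ext (Subtype.mk.inj h))
    · obtain ⟨x, t, rfl⟩ := x
      have : (y ^ p ^ k) ^ p = 1 := by
        exact orderOf_dvd_iff_pow_eq_one.1 hz.dvd
      change ((y ^ p ^ k) ^ t) ^ p = 1
      rw [← zpow_natCast, zpow_comm, zpow_natCast, this, one_zpow]
    · obtain ⟨x, t, rfl⟩ := x
      refine ⟨y ^ t, ?_⟩
      change _ = ((y ^ p ^ k) ^ t)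
      rw [← zpow_natCast, zpow_comm, zpow_natCast]
  · rw [pow_zero]
    unfold tau
    have : Nonempty {x : Multiplicative (ZMod (p ^ n)) // x ^ p = 1 ∧ ∃ y, y ^ (p ^ k) = x} :=
      ⟨⟨1, one_pow _, 1, one_pow _⟩⟩
    exact Nat.card_pos

/-- weights -/
def wt (p : ℕ) : ℕ → ℕ
  | 0 => p
  | k + 1 => p ^ (k + 2) - p ^ (k + 1)

lemma sum_wt (p : ℕ) (hp : 0 < p) (K : ℕ) : ∑ k ∈ Finset.range (K + 1), wt p k = p ^ (K + 1) := by
  induction K with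
  | zero => simp [wt]
  | succ K ih =>
    rw [Finset.sum_range_succ, ih]
    have : p ^ (K + 1) ≤ p ^ (K + 2) := Nat.pow_le_pow_right hp (by omega)
    simp only [wt]
    exact Nat.add_sub_cancel' this

lemma sum_wt_le (p : ℕ) (hp : 0 < p) (N : ℕ) (hN : 0 < N) (K : ℕ) :
    ∑ k ∈ Finset.range K, wt p k * (if p ^ (k + 1) ∣ N then 1 else 0) ≤ N := by
  induction K with
  | zero => simp
  | succ K ih =>
    by_cases h : p ^ (K + 1) ∣ N
    · calc _ ≤ ∑ k ∈ Finset.range (K + 1), wt p k := by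
            apply Finset.sum_le_sum
            intro k _
            split_ifs <;> simp
        _ = p ^ (K + 1) := sum_wt p hp K
        _ ≤ N := Nat.le_of_dvd hN h
    · rw [Finset.sum_range_succ, if_neg h]
      simpa using ih

lemma le_sum_wt (p : ℕ) (hp : 0 < p) (n K : ℕ) (hn : 1 ≤ n) (hK : n ≤ K) :
    p ^ n ≤ ∑ k ∈ Finset.range K, wt p k * (if p ^ (k + 1) ∣ p ^ n then 1 else 0) := by
  obtain ⟨n, rfl⟩ : ∃ j, n = j + 1 := ⟨n - 1, by omega⟩
  rw [← sum_wt p hp n]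
  calc _ = ∑ k ∈ Finset.range (n + 1),
        wt p k * (if p ^ (k + 1) ∣ p ^ (n + 1) then 1 else 0) := by
        apply Finset.sum_congr rfl
        intro k hk
        rw [if_pos (pow_dvd_pow _ (by simpa using hk)), mul_one]
    _ ≤ _ := by
      rw [sum_wt p hp n]
      exact Finset.sum_le_sum_of_subset (Finset.range_mono hK)

lemma sum_le_prod {ι : Type*} (S : Finset ι) (N : ι → ℕ) (h : ∀ i, 2 ≤ N i) :
    ∑ i ∈ S, N i ≤ ∏ i ∈ S, N i ∧ (S.Nonempty → 2 ≤ ∏ i ∈ S, N i) := by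
  classical
  induction S using Finset.induction_on with
  | empty => simp
  | insert a S ha ih =>
    rw [Finset.sum_insert ha, Finset.prod_insert ha]
    have h2 := h a
    rcases S.eq_empty_or_nonempty with rfl | hS
    · simpa using h2
    · have := ih.2 hS
      have := ih.1
      constructor
      · nlinarith
      · intro _; nlinarith

/-- Each finite abelian group has weighted count bounded by its cardinality. -/
lemma exists_count (p : ℕ) (hp : p.Prime) (A : Type*) [CommGroup A] [Finite A] :
    ∃ r : ℕ → ℕ, (∀ k, tau p k A ≤ p ^ r k) ∧
      ∀ K, ∑ k ∈ Finset.range K, wt p k * r k ≤ Nat.card A := by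
  obtain ⟨ι, _, N, hN, ⟨e⟩⟩ := CommGroup.equiv_prod_multiplicative_zmod_of_finite A
  have : ∀ i, NeZero (N i) := fun i => ⟨by have := hN i; omega⟩
  refine ⟨fun k => ∑ i, if p ^ (k + 1) ∣ N i then 1 else 0, fun k => ?_, fun K => ?_⟩
  · refine (tau_mono p k e.toMonoidHom e.injective).trans ?_
    rw [tau_pi, ← Finset.prod_pow_eq_pow_sum]
    exact Finset.prod_le_prod' fun i _ => tau_zmod_le p k _ hp (NeZero.ne _)
  · rw [Nat.card_congr e.toEquiv, Nat.card_pi]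
    simp_rw [Finset.mul_sum]
    rw [Finset.sum_comm]
    refine (Finset.sum_le_sum fun i _ => sum_wt_le p hp.pos (N i) (NeZero.pos _) K).trans ?_
    refine (sum_le_prod Finset.univ N hN).1.trans (le_of_eq ?_)
    exact Finset.prod_congr rfl fun i _ => by simp

lemma main {G : Type} [CommGroup G] [Finite G] (p : ℕ) (hp : p.Prime) (m : ℕ)
    (f : G →* Equiv.Perm (Fin m)) (hf : Function.Injective f) :
    ∃ r : ℕ → ℕ, (∀ k, tau p k G ≤ p ^ r k) ∧
      ∀ K, ∑ k ∈ Finset.range K, wt p k * r k ≤ m := by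
  classical
  let : MulAction G (Fin m) := MulAction.compHom (Fin m) f
  have hsm : ∀ (g : G) (x : Fin m), g • x = f g x := fun g x => rfl
  let Ω := MulAction.orbitRel.Quotient G (Fin m)
  have : Fintype Ω := Fintype.ofFinite _
  let A : Ω → Type := fun ω => G ⧸ MulAction.stabilizer G (Quotient.out ω : Fin m)
  let : ∀ ω, CommGroup (A ω) := fun ω => inferInstanceAs
    (CommGroup (G ⧸ MulAction.stabilizer G (Quotient.out ω : Fin m)))
  have : ∀ ω, Finite (A ω) := fun ω => inferInstanceAs
    (Finite (G ⧸ MulAction.stabilizer G (Quotient.out ω : Fin m)))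
  have hcard : m = ∑ ω, Nat.card (A ω) := by
    have := Nat.card_congr (MulAction.selfEquivSigmaOrbitsQuotientStabilizer G (Fin m))
    rw [Nat.card_sigma] at this
    simpa using this
  let φ : G →* ∀ ω, A ω := MonoidHom.pi fun ω =>
    QuotientGroup.mk' (MulAction.stabilizer G (Quotient.out ω : Fin m))
  have hφ : Function.Injective φ := by
    rw [injective_iff_map_eq_one]
    intro g hg
    apply hf
    rw [map_one]
    ext x : 1
    let ω : Ω := Quotient.mk _ x
    have h1 : g ∈ MulAction.stabilizer G (Quotient.out ω : Fin m) :=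
      (QuotientGroup.eq_one_iff g).1 (congrFun hg ω)
    have h2 : (Quotient.out ω : Fin m) ∈ MulAction.orbit G x :=
      MulAction.orbitRel_apply.1 (Quotient.exact (Quotient.out_eq ω))
    obtain ⟨t, ht⟩ := h2
    have ht : t • x = Quotient.out ω := ht
    rw [MulAction.mem_stabilizer_iff, ← ht, smul_smul, mul_comm, ← smul_smul] at h1
    exact MulAction.injective t h1
  choose r hr1 hr2 using fun ω => exists_count p hp (A ω)
  refine ⟨fun k => ∑ ω, r ω k, fun k => ?_, fun K => ?_⟩
  · refine (tau_mono p k φ hφ).trans ?_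
    rw [tau_pi, ← Finset.prod_pow_eq_pow_sum]
    exact Finset.prod_le_prod' fun ω _ => hr1 ω k
  · rw [hcard]
    simp_rw [Finset.mul_sum]
    rw [Finset.sum_comm]
    exact Finset.sum_le_sum fun ω _ => hr2 ω K

end CycBound

/-- If there is an injective group homomorphism
`ℤ/p^{n_1} × ⋯ × ℤ/p^{n_s} ↪ S_m`, then `p^{n_1} + ⋯ + p^{n_s} ≤ m`. -/
theorem cyclic_product_embeds_in_symm_group_bound
    (p : ℕ) (hp : p.Prime) (s : ℕ) (hs : 1 ≤ s) (n : Fin s → ℕ)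
    (hn : ∀ i, 1 ≤ n i) (m : ℕ) (hm : 0 < m)
    (f : ((i : Fin s) → Multiplicative (ZMod (p ^ n i))) →* Equiv.Perm (Fin m))
    (hf : Function.Injective f) :
    ∑ i, p ^ n i ≤ m := by
  have : ∀ i, NeZero (p ^ n i) := fun i => ⟨pow_ne_zero _ hp.ne_zero⟩
  obtain ⟨r, h1, h2⟩ := CycBound.main p hp m f hf
  have h3 : ∀ k, (∑ i, if p ^ (k + 1) ∣ p ^ n i then 1 else 0) ≤ r k := by
    intro k
    refine (Nat.pow_le_pow_iff_right hp.one_lt).1 (le_trans ?_ (h1 k))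
    rw [CycBound.tau_pi, ← Finset.prod_pow_eq_pow_sum]
    exact Finset.prod_le_prod' fun i _ => CycBound.le_tau_zmod p k _ hp
  let K := ∑ i, n i
  refine le_trans ?_ (h2 K)
  refine le_trans ?_ (Finset.sum_le_sum fun k _ => Nat.mul_le_mul_left _ (h3 k))
  simp_rw [Finset.mul_sum]
  rw [Finset.sum_comm]
  exact Finset.sum_le_sum fun i _ => CycBound.le_sum_wt p hp.pos _ _ (hn i)
    (Finset.single_le_sum (f := n) (fun _ _ => Nat.zero_le _) (Finset.mem_univ i))
end

section
/- Let μ = (μ_1, …, μ_r) be a nonempty partition (μ_1 ≥ ⋯ ≥ μ_r > 0, r ≥ 1). Then μ is both 2-regular and a 4-core if and only if exactly one of the following holds: (i) μ_r = 1 and there exists an integer s with 0 ≤ s ≤ r−1 such that μ_i − μ_{i+1} = 3 for all 1 ≤ i ≤ s and μ_i − μ_{i+1} = 1 for all s+1 ≤ i ≤ r−1; (ii) μ_r ∈ {2,3} and μ_i − μ_{i+1} = 3 for all 1 ≤ i ≤ r−1. -/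
/-- The conjugate partition value `μ'_j = #{i : 1 ≤ i ≤ r, μ_i ≥ j}`,
for a partition `μ` supported on indices `1, …, r`. -/
def muConj (r : ℕ) (μ : ℕ → ℕ) (j : ℕ) : ℕ :=
  ((Finset.Icc 1 r).filter (fun i => j ≤ μ i)).card

/-- The hook length `h_{i,j} = (μ_i − j) + (μ'_j − i) + 1` of the cell `(i,j)`. -/
def muHook (r : ℕ) (μ : ℕ → ℕ) (i j : ℕ) : ℕ :=
  (μ i - j) + (muConj r μ j - i) + 1

theorem muConj_eq_aux (r : ℕ) (μ : ℕ → ℕ)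
    (hdec : ∀ i j, 1 ≤ i → i ≤ j → j ≤ r → μ j ≤ μ i)
    (c j : ℕ) (hc1 : 1 ≤ c) (hc : c ≤ r) (hj : j ≤ μ c) (hj' : μ (c + 1) < j) :
    muConj r μ j = c := by
  unfold muConj
  have h : (Finset.Icc 1 r).filter (fun i => j ≤ μ i) = Finset.Icc 1 c := by
    ext k
    simp only [Finset.mem_filter, Finset.mem_Icc]
    constructor
    · rintro ⟨⟨h1, h2⟩, h3⟩
      refine ⟨h1, ?_⟩
      by_contra hk
      have := hdec (c + 1) k (by omega) (by omega) h2
      omega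
    · rintro ⟨h1, h2⟩
      have := hdec k c h1 h2 hc
      exact ⟨⟨h1, by omega⟩, by omega⟩
  rw [h]; simp

theorem exists_row_aux (r : ℕ) (μ : ℕ → ℕ) (hzero : ∀ i, r < i → μ i = 0)
    (j : ℕ) (hj : 1 ≤ j) (n : ℕ) : ∀ i, r - i = n → i ≤ r → j ≤ μ i →
    ∃ c, i ≤ c ∧ c ≤ r ∧ j ≤ μ c ∧ μ (c + 1) < j := by
  induction n with
  | zero =>
    intro i h1 h2 h3
    exact ⟨i, le_refl _, h2, h3, by rw [hzero (i + 1) (by omega)]; omega⟩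
  | succ n ih =>
    intro i h1 h2 h3
    by_cases h : μ (i + 1) < j
    · exact ⟨i, le_refl _, h2, h3, h⟩
    · obtain ⟨c, a1, a2, a3, a4⟩ := ih (i + 1) (by omega) (by omega) (by omega)
      exact ⟨c, by omega, a2, a3, a4⟩

/-- The core condition, restated without the conjugate partition. -/
theorem core_iff_aux (r : ℕ) (μ : ℕ → ℕ)
    (hdec : ∀ i j, 1 ≤ i → i ≤ j → j ≤ r → μ j ≤ μ i)
    (hzero : ∀ i, r < i → μ i = 0) :
    (∀ i j, 1 ≤ i → i ≤ r → 1 ≤ j → j ≤ μ i → ¬ (4 ∣ muHook r μ i j)) ↔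
    (∀ i c j, 1 ≤ i → i ≤ c → c ≤ r → j ≤ μ c → μ (c + 1) < j →
      ¬ (4 ∣ (μ i - j) + (c - i) + 1)) := by
  constructor
  · intro H i c j h1 h2 h3 h4 h5
    have := H i j h1 (by omega) (by omega) (h4.trans (hdec i c h1 h2 h3))
    rwa [muHook, muConj_eq_aux r μ hdec c j (by omega) h3 h4 h5] at this
  · intro H i j h1 h2 h3 h4
    obtain ⟨c, a1, a2, a3, a4⟩ := exists_row_aux r μ hzero j h3 _ i rfl h2 h4
    rw [muHook, muConj_eq_aux r μ hdec c j (by omega) a2 a3 a4]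
    exact H i c j h1 a1 a2 a3 a4

theorem all_three_aux (μ : ℕ → ℕ) (i c : ℕ) (hic : i ≤ c)
    (h : ∀ k, i ≤ k → k < c → μ k - μ (k + 1) = 3) :
    μ i + 3 * i = μ c + 3 * c := by
  induction c, hic using Nat.le_induction with
  | base => rfl
  | succ c hc ih =>
    have := ih (fun k h1 h2 => h k h1 (by omega))
    have := h c hc (by omega)
    omega

theorem all_odd_aux (μ : ℕ → ℕ) (i c : ℕ) (hic : i ≤ c)
    (h : ∀ k, i ≤ k → k < c → μ k - μ (k + 1) = 3 ∨ μ k - μ (k + 1) = 1) :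
    (μ i + i) % 2 = (μ c + c) % 2 := by
  induction c, hic using Nat.le_induction with
  | base => rfl
  | succ c hc ih =>
    have := ih (fun k h1 h2 => h k h1 (by omega))
    have := h c hc (by omega)
    omega

/-- Sufficient condition for the restated core property. -/
theorem core_of_diffs_aux (r : ℕ) (μ : ℕ → ℕ)
    (hdec : ∀ i j, 1 ≤ i → i ≤ j → j ≤ r → μ j ≤ μ i)
    (h : ∀ c, 1 ≤ c → c ≤ r →
      (μ c - μ (c + 1) = 1 ∧
        ∀ k, 1 ≤ k → k < c → μ k - μ (k + 1) = 3 ∨ μ k - μ (k + 1) = 1) ∨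
      (μ c - μ (c + 1) ≤ 3 ∧ ∀ k, 1 ≤ k → k < c → μ k - μ (k + 1) = 3)) :
    ∀ i c j, 1 ≤ i → i ≤ c → c ≤ r → j ≤ μ c → μ (c + 1) < j →
      ¬ (4 ∣ (μ i - j) + (c - i) + 1) := by
  intro i c j h1 h2 h3 h4 h5
  have hm := hdec i c h1 h2 h3
  rcases h c (by omega) h3 with ⟨a, b⟩ | ⟨a, b⟩
  · have := all_odd_aux μ i c h2 (fun k k1 k2 => b k (by omega) k2)
    omega
  · have := all_three_aux μ i c h2 (fun k k1 k2 => b k (by omega) k2)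
    omega

/-- Differences forced by the core property. -/
theorem diffs_of_core_aux (r : ℕ) (μ : ℕ → ℕ)
    (hpos : ∀ i, 1 ≤ i → i ≤ r → 0 < μ i)
    (hzero : ∀ i, r < i → μ i = 0)
    (hs : ∀ i, 1 ≤ i → i < r → μ (i + 1) < μ i)
    (H : ∀ i c j, 1 ≤ i → i ≤ c → c ≤ r → j ≤ μ c → μ (c + 1) < j →
      ¬ (4 ∣ (μ i - j) + (c - i) + 1)) :
    (∀ i, 1 ≤ i → i ≤ r → μ (i + 1) < μ i ∧ μ i - μ (i + 1) ≤ 3) ∧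
    (∀ i, 1 ≤ i → i < r → μ i - μ (i + 1) = 3 ∨
      (μ i - μ (i + 1) = 1 ∧ μ (i + 1) - μ (i + 2) = 1)) := by
  have hs' : ∀ i, 1 ≤ i → i ≤ r → μ (i + 1) < μ i := by
    intro i h1 h2
    by_cases h : i < r
    · exact hs i h1 h
    · rw [hzero (i + 1) (by omega)]; exact hpos i h1 h2
  have A : ∀ i, 1 ≤ i → i ≤ r → μ (i + 1) < μ i ∧ μ i - μ (i + 1) ≤ 3 := by
    intro i h1 h2
    refine ⟨hs' i h1 h2, ?_⟩
    by_contra hlt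
    exact H i i (μ i - 3) h1 le_rfl h2 (by omega) (by omega) (by omega)
  refine ⟨A, ?_⟩
  intro i h1 h2
  obtain ⟨a1, a2⟩ := A i h1 (by omega)
  obtain ⟨b1, b2⟩ := A (i + 1) (by omega) (by omega)
  rw [show i + 1 + 1 = i + 2 from rfl] at b1 b2
  have n2 : μ i - μ (i + 1) ≠ 2 := by
    intro h
    exact H i (i + 1) (μ (i + 1)) h1 (by omega) (by omega) le_rfl b1 (by omega)
  by_cases h3 : μ i - μ (i + 1) = 3
  · exact Or.inl h3
  · right
    refine ⟨by omega, ?_⟩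
    by_contra h
    exact H i (i + 1) (μ (i + 1) - 1) h1 (by omega) (by omega) (by omega)
      (by rw [show i + 1 + 1 = i + 2 from rfl]; omega) (by omega)

theorem exists_split_aux (d : ℕ → ℕ) (r : ℕ) (hr : 1 ≤ r)
    (h : ∀ i, 1 ≤ i → i < r → d i = 3 ∨ (d i = 1 ∧ d (i + 1) = 1)) :
    ∃ s, s ≤ r - 1 ∧ (∀ i, 1 ≤ i → i ≤ s → d i = 3) ∧
      (∀ i, s + 1 ≤ i → i ≤ r - 1 → d i = 1) := by
  induction r, hr using Nat.le_induction with
  | base => exact ⟨0, by omega, fun i h1 h2 => by omega, fun i h1 h2 => by omega⟩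
  | succ r hr ih =>
    obtain ⟨s, s1, s2, s3⟩ := ih (fun i h1 h2 => h i h1 (by omega))
    by_cases hsr : s = r - 1
    · rcases h r hr (by omega) with h3 | ⟨h3, -⟩
      · refine ⟨r, by omega, fun i h1 h2 => ?_, fun i h1 h2 => by omega⟩
        by_cases hir : i = r
        · rw [hir, h3]
        · exact s2 i h1 (by omega)
      · refine ⟨s, by omega, s2, fun i h1 h2 => ?_⟩
        have : i = r := by omega
        rw [this, h3]
    · refine ⟨s, by omega, s2, fun i h1 h2 => ?_⟩
      by_cases hir : i = r
      · have e := s3 (r - 1) (by omega) le_rfl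
        have := h (r - 1) (by omega) (by omega)
        rw [show r - 1 + 1 = r by omega] at this
        rw [hir]; omega
      · exact s3 i h1 (by omega)

/-- A partition `μ = (μ_1, …, μ_r)` is both 2-regular and a 4-core if and only if
exactly one of the following holds:
(i) `μ_r = 1` and there is `0 ≤ s ≤ r−1` with `μ_i − μ_{i+1} = 3` for `1 ≤ i ≤ s`
and `μ_i − μ_{i+1} = 1` for `s+1 ≤ i ≤ r−1`;
(ii) `μ_r ∈ {2,3}` and `μ_i − μ_{i+1} = 3` for all `1 ≤ i ≤ r−1`. -/
theorem two_regular_four_core_characterization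
    (r : ℕ) (μ : ℕ → ℕ) (hr : 1 ≤ r)
    (hdec : ∀ i j, 1 ≤ i → i ≤ j → j ≤ r → μ j ≤ μ i)
    (hpos : ∀ i, 1 ≤ i → i ≤ r → 0 < μ i)
    (hzero : ∀ i, r < i → μ i = 0) :
    ((∀ i, 1 ≤ i → i < r → μ (i + 1) < μ i) ∧
      (∀ i j, 1 ≤ i → i ≤ r → 1 ≤ j → j ≤ μ i → ¬ (4 ∣ muHook r μ i j)))
    ↔ Xor'
        (μ r = 1 ∧ ∃ s, s ≤ r - 1 ∧
          (∀ i, 1 ≤ i → i ≤ s → μ i - μ (i + 1) = 3) ∧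
          (∀ i, s + 1 ≤ i → i ≤ r - 1 → μ i - μ (i + 1) = 1))
        ((μ r = 2 ∨ μ r = 3) ∧
          ∀ i, 1 ≤ i → i ≤ r - 1 → μ i - μ (i + 1) = 3) := by
  rw [core_iff_aux r μ hdec hzero]
  have hz := hzero (r + 1) (by omega)
  constructor
  · rintro ⟨hs, H⟩
    obtain ⟨A, B⟩ := diffs_of_core_aux r μ hpos hzero hs H
    obtain ⟨s, s1, s2, s3⟩ := exists_split_aux (fun i => μ i - μ (i + 1)) r hr B
    obtain ⟨a1, a2⟩ := A r hr le_rfl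
    by_cases h1 : μ r = 1
    · exact Or.inl ⟨⟨h1, s, s1, s2, s3⟩, fun h => by omega⟩
    · refine Or.inr ⟨⟨by omega, ?_⟩, fun h => h1 h.1⟩
      have hsr : s = r - 1 := by
        by_contra hne
        have e := s3 (r - 1) (by omega) le_rfl
        have b := B (r - 1) (by omega) (by omega)
        simp only [show r - 1 + 1 = r by omega, show r - 1 + 2 = r + 1 by omega] at e b
        omega
      rw [← hsr]; exact s2
  · intro hx
    rcases hx with ⟨⟨h1, s, s1, s2, s3⟩, -⟩ | ⟨⟨h1, h2⟩, -⟩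
    · refine ⟨fun i i1 i2 => ?_, core_of_diffs_aux r μ hdec fun c c1 c2 => ?_⟩
      · by_cases his : i ≤ s
        · have := s2 i i1 his
          omega
        · have := s3 i (by omega) (by omega)
          omega
      · by_cases hcs : c ≤ s
        · exact Or.inr ⟨by rw [s2 c c1 hcs], fun k k1 k2 => s2 k k1 (by omega)⟩
        · refine Or.inl ⟨?_, fun k k1 k2 => ?_⟩
          · by_cases hcr : c = r
            · rw [hcr]; omega
            · exact s3 c (by omega) (by omega)
          · by_cases hks : k ≤ s
            · exact Or.inl (s2 k k1 hks)
            · exact Or.inr (s3 k (by omega) (by omega))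
    · refine ⟨fun i i1 i2 => ?_, core_of_diffs_aux r μ hdec fun c c1 c2 => Or.inr ⟨?_, fun k k1 k2 => h2 k k1 (by omega)⟩⟩
      · have := h2 i i1 (by omega)
        omega
      · by_cases hcr : c = r
        · rw [hcr]; omega
        · rw [h2 c c1 (by omega)]
end

section
/- Let μ = (μ_1, …, μ_r) be a 2-regular partition (so μ_1 > μ_2 > ⋯ > μ_r > 0) which is a 4-core, i.e. no hook length of the Young diagram [μ] is divisible by 4. Then 1 ≤ μ_i − μ_{i+1} ≤ 3 for all 1 ≤ i ≤ r−1, and μ_i − μ_{i+1} ≠ 2 for all 1 ≤ i ≤ r−2. -/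
/-- The column `j` has length `k` when row `k` reaches it and row `k + 1` does not. -/
lemma muConj_eq_of_between (r : ℕ) (μ : ℕ → ℕ)
    (hdec : ∀ i j, 1 ≤ i → i ≤ j → j ≤ r → μ j ≤ μ i)
    (k j : ℕ) (hkr : k ≤ r) (h1 : j ≤ μ k) (h2 : μ (k + 1) < j) :
    muConj r μ j = k := by
  have h : (Finset.Icc 1 r).filter (fun i => j ≤ μ i) = Finset.Icc 1 k := by
    ext i
    simp only [Finset.mem_filter, Finset.mem_Icc]
    constructor
    · rintro ⟨⟨hi, hir⟩, hj⟩
      refine ⟨hi, ?_⟩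
      by_contra hlt
      have := hdec (k + 1) i (by omega) (by omega) hir
      omega
    · rintro ⟨hi, hik⟩
      have := hdec i k hi hik hkr
      exact ⟨⟨hi, by omega⟩, by omega⟩
  simp [muConj, h]

/-- If `μ` is a 2-regular 4-core partition then `1 ≤ μ_i − μ_{i+1} ≤ 3` for
`1 ≤ i ≤ r−1`, and `μ_i − μ_{i+1} ≠ 2` for `1 ≤ i ≤ r−2`. -/
theorem two_regular_four_core_differences
    (r : ℕ) (μ : ℕ → ℕ) (hr : 1 ≤ r)
    (hdec : ∀ i j, 1 ≤ i → i ≤ j → j ≤ r → μ j ≤ μ i)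
    (hpos : ∀ i, 1 ≤ i → i ≤ r → 0 < μ i)
    (hzero : ∀ i, r < i → μ i = 0)
    (hreg : ∀ i, 1 ≤ i → i < r → μ (i + 1) < μ i)
    (hcore : ∀ i j, 1 ≤ i → i ≤ r → 1 ≤ j → j ≤ μ i → ¬ (4 ∣ muHook r μ i j)) :
    (∀ i, 1 ≤ i → i ≤ r - 1 → 1 ≤ μ i - μ (i + 1) ∧ μ i - μ (i + 1) ≤ 3) ∧
    (∀ i, 1 ≤ i → i ≤ r - 2 → μ i - μ (i + 1) ≠ 2) := by
  constructor
  · intro i hi hir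
    have hlt := hreg i hi (by omega)
    refine ⟨by omega, ?_⟩
    by_contra hd
    have hc := muConj_eq_of_between r μ hdec i (μ i - 3) (by omega) (by omega) (by omega)
    apply hcore i (μ i - 3) hi (by omega) (by omega) (by omega)
    unfold muHook
    rw [hc]
    omega
  · intro i hi hir hd
    have hlt := hreg (i + 1) (by omega) (by omega)
    have hp := hpos (i + 1) (by omega) (by omega)
    have hc := muConj_eq_of_between r μ hdec (i + 1) (μ (i + 1)) (by omega) le_rfl hlt
    apply hcore i (μ (i + 1)) hi (by omega) (by omega) (by omega)
    unfold muHook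
    rw [hc]
    omega
end

section
/- Let p ≥ 3 be a prime and F an algebraically closed field of characteristic p. Let n be a positive integer, let g be any polynomial in F[x_1,…,x_p], and set f = (x_1 x_2 ⋯ x_p)^{p−1} · g + Σ_{i=1}^{p} ∏_{j ≠ i} x_j^{n(p−1)} (the i-th summand being the product of x_j^{n(p−1)} over all 1 ≤ j ≤ p with j ≠ i). Then f is not divisible in F[x_1,…,x_p] by any nonzero linear form a_1 x_1 + ⋯ + a_p x_p with (a_1,…,a_p) ≠ (0,…,0); equivalently, f does not lie in the principal ideal generated by any nonzero linear form. -/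
open MvPolynomial

/-- A point on the hyperplane with exactly one vanishing coordinate. -/
lemma exists_point {p : ℕ} (hp3 : 3 ≤ p) {F : Type*} [Field F] [Infinite F]
    (a : Fin p → F) (ha : a ≠ 0) :
    ∃ (k : Fin p) (x : Fin p → F), x k = 0 ∧ (∀ j, j ≠ k → x j ≠ 0) ∧ ∑ i, a i * x i = 0 := by
  classical
  obtain ⟨i, hi⟩ := Function.ne_iff.mp ha
  have hi : a i ≠ 0 := hi
  by_cases h : ∃ i', i' ≠ i ∧ a i' ≠ 0
  · obtain ⟨i', hne, hi'⟩ := h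
    have hk : ∃ k : Fin p, k ∉ ({i, i'} : Finset (Fin p)) := by
      by_contra! hcon
      have h1 : (Finset.univ : Finset (Fin p)).card ≤ ({i, i'} : Finset (Fin p)).card :=
        Finset.card_le_card (fun x _ => hcon x)
      have h2 := Finset.card_le_two (a := i) (b := i')
      rw [Finset.card_univ, Fintype.card_fin] at h1
      omega
    obtain ⟨k, hk⟩ := hk
    simp only [Finset.mem_insert, Finset.mem_singleton, not_or] at hk
    obtain ⟨hki, hki'⟩ := hk
    set c : F := ∑ j ∈ (Finset.univ.erase i).erase i', a j * (if j = k then 0 else 1) with hc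
    obtain ⟨t, ht⟩ := Infinite.exists_notMem_finset ({0, -c / a i} : Finset F)
    simp only [Finset.mem_insert, Finset.mem_singleton, not_or] at ht
    obtain ⟨ht0, htc⟩ := ht
    refine ⟨k, fun j => if j = i then t else if j = i' then (-c - a i * t) / a i'
      else if j = k then 0 else 1, ?_, ?_, ?_⟩
    · simp [hki, hki']
    · intro j hj
      dsimp only
      split_ifs
      · exact ht0
      · refine div_ne_zero ?_ hi'
        intro h0
        apply htc
        rw [eq_div_iff hi]
        linear_combination -h0
      · exact one_ne_zero
    · rw [← Finset.add_sum_erase _ _ (Finset.mem_univ i),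
        ← Finset.add_sum_erase _ _ (Finset.mem_erase.mpr ⟨hne, Finset.mem_univ i'⟩)]
      have hrest : ∑ j ∈ (Finset.univ.erase i).erase i', a j * (if j = i then t else
          if j = i' then (-c - a i * t) / a i' else if j = k then 0 else 1) = c := by
        rw [hc]
        refine Finset.sum_congr rfl fun j hj => ?_
        simp only [Finset.mem_erase] at hj
        rw [if_neg hj.2.1, if_neg hj.1]
      rw [hrest]
      dsimp only
      rw [if_pos rfl, if_neg hne, if_pos rfl, mul_div_cancel₀ _ hi']
      ring
  · push Not at h
    refine ⟨i, fun j => if j = i then 0 else 1, by simp, fun j hj => by simp [hj], ?_⟩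
    refine Finset.sum_eq_zero fun j _ => ?_
    by_cases hj : j = i
    · simp [hj]
    · simp [h j hj]

/-- The polynomial
`f = (x_1 ⋯ x_p)^{p−1} · g + Σ_{i=1}^p ∏_{j ≠ i} x_j^{n(p−1)}`
is not divisible by any nonzero linear form `a_1 x_1 + ⋯ + a_p x_p`. -/
theorem no_linear_factor
    (p : ℕ) (hp : p.Prime) (hp3 : 3 ≤ p)
    (F : Type*) [Field F] [IsAlgClosed F] [CharP F p]
    (n : ℕ) (hn : 0 < n) (g : MvPolynomial (Fin p) F)
    (a : Fin p → F) (ha : a ≠ 0) :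
    ¬ ((∑ i, C (a i) * X i) ∣
        ((∏ j, X j) ^ (p - 1) * g +
          ∑ i : Fin p, ∏ j ∈ Finset.univ.erase i, (X j : MvPolynomial (Fin p) F) ^ (n * (p - 1)))) := by
  classical
  haveI : Infinite F := inferInstance
  obtain ⟨k, x, hk, hx, hsum⟩ := exists_point hp3 a ha
  rintro ⟨q, hq⟩
  have hm : n * (p - 1) ≠ 0 := Nat.mul_ne_zero hn.ne' (by omega)
  have he := congrArg (MvPolynomial.eval x) hq
  simp only [map_add, map_mul, map_pow, map_sum, map_prod, eval_X, eval_C, hsum, zero_mul] at he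
  rw [Finset.prod_eq_zero (Finset.mem_univ k) hk, zero_pow (by omega), zero_mul, zero_add,
    Finset.sum_eq_single k] at he
  · rw [Finset.prod_eq_zero_iff] at he
    obtain ⟨j, hj, hj0⟩ := he
    exact pow_ne_zero _ (hx j (Finset.ne_of_mem_erase hj)) hj0
  · intro b _ hb
    refine Finset.prod_eq_zero (Finset.mem_erase.mpr ⟨hb.symm, Finset.mem_univ k⟩) ?_
    rw [hk, zero_pow hm]
  · intro h
    exact absurd (Finset.mem_univ k) h
end
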